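/- Let Q ⊂ ℂ⁴ be the real hypersurface Q = {(z₁,z₂,ζ,w) ∈ ℂ⁴ : Im w = 2 Re(z₁·conj ζ + z₂·(conj ζ)²)} and let ρ(z₁,z₂,ζ,w) = Im w − 2 Re(z₁·conj ζ + z₂·(conj ζ)²). Then for all α₁, α₂ ∈ ℂ and α₃ ∈ ℝ, the map X : ℂ⁴ → ℂ⁴ given by X(z₁,z₂,ζ,w) = (α₁ z₁ − (conj α₂) ζ², (2α₁ − α₃) z₂ + α₂ ζ, (α₃ − conj α₁) ζ, α₃ w) satisfies: for every point p ∈ Q the real Fréchet derivative of ρ at p evaluated at X(p) equals zero. In other words, this weight-zero linear vector field is tangent to Q at every point of Q. -/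

import Mathlib

open Complex

/-- The real derivative of the defining function
`Im w - 2 Re (z₁ ζ̄ + z₂ ζ̄²)` at `p`, evaluated at `v`. -/
lemma fderiv_im_sub_two_mul_re_apply (p v : ℂ × ℂ × ℂ × ℂ) :
    fderiv ℝ (fun p : ℂ × ℂ × ℂ × ℂ => p.2.2.2.im -
      2 * (p.1 * (starRingEnd ℂ) p.2.2.1 + p.2.1 * ((starRingEnd ℂ) p.2.2.1) ^ 2).re) p v =
    v.2.2.2.im - 2 * (v.1 * (starRingEnd ℂ) p.2.2.1 + p.1 * (starRingEnd ℂ) v.2.2.1 +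
      v.2.1 * ((starRingEnd ℂ) p.2.2.1) ^ 2 +
      2 * p.2.1 * (starRingEnd ℂ) p.2.2.1 * (starRingEnd ℂ) v.2.2.1).re := by
  have hz₁ := hasFDerivAt_fst (𝕜 := ℝ) (p := p)
  have h := hasFDerivAt_snd (𝕜 := ℝ) (p := p)
  have hz₂ := h.fst
  have hζ := conjCLE.toContinuousLinearMap.hasFDerivAt.comp p h.snd.fst
  have hw := imCLM.hasFDerivAt.comp p h.snd.snd
  have hre := reCLM.hasFDerivAt.comp p ((hz₁.mul hζ).add (hz₂.mul (hζ.pow 2)))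
  refine (congrArg (fun L => L v) (hw.sub (hre.const_mul 2)).fderiv).trans ?_
  simp
  ring

/-- The weight `0` graded vector fields
`(α₁ z₁ − ᾱ₂ ζ², (2α₁ − α₃) z₂ + α₂ ζ, (α₃ − ᾱ₁) ζ, α₃ w)` are tangent to the
weighted model hypersurface `Q = {Im w = 2 Re (z₁ ζ̄ + z₂ ζ̄²)}` at every
point of `Q`. -/
theorem g_zero_tangent_to_cubic_model
    (Q : Set (ℂ × ℂ × ℂ × ℂ))
    (hQ : Q = {p : ℂ × ℂ × ℂ × ℂ | p.2.2.2.im =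
      2 * (p.1 * (starRingEnd ℂ) p.2.2.1 + p.2.1 * ((starRingEnd ℂ) p.2.2.1) ^ 2).re})
    (ρ : ℂ × ℂ × ℂ × ℂ → ℝ)
    (hρ : ∀ p, ρ p = p.2.2.2.im -
      2 * (p.1 * (starRingEnd ℂ) p.2.2.1 + p.2.1 * ((starRingEnd ℂ) p.2.2.1) ^ 2).re)
    (α₁ α₂ : ℂ) (α₃ : ℝ)
    (X : ℂ × ℂ × ℂ × ℂ → ℂ × ℂ × ℂ × ℂ)
    (hX : ∀ p, X p = (α₁ * p.1 - (starRingEnd ℂ) α₂ * p.2.2.1 ^ 2,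
      (2 * α₁ - (α₃ : ℂ)) * p.2.1 + α₂ * p.2.2.1,
      ((α₃ : ℂ) - (starRingEnd ℂ) α₁) * p.2.2.1,
      (α₃ : ℂ) * p.2.2.2)) :
    ∀ p ∈ Q, fderiv ℝ ρ p (X p) = 0 := by
  subst hQ
  intro p hp
  rw [Set.mem_ofPred_eq] at hp
  rw [funext hρ, fderiv_im_sub_two_mul_re_apply, hX]
  simp only [map_sub, map_mul, conj_ofReal, conj_conj, im_ofReal_mul, hp]
  simp [pow_two]
  ring
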